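/- arXiv:0906.3258 — 2 statements merged into one kernel-verified Lean document; each statement's English description precedes it below -/
import Mathlib

section
/- The discrete Krichever–Novikov Yang–Baxter map satisfies the parametric Yang–Baxter equation: for every k ∈ ℂ, all points 𝐚 = (a,A), 𝐛 = (b,B), 𝐜 = (c,C) on the Jacobi quartic E_k = {(a,A) ∈ ℂ² : A² = a⁴ + k a² + 1}, and all triples of points of ℂ² such that every denominator encountered in evaluating both compositions R^{(2,3)}_{(𝐛,𝐜)} ∘ R^{(1,3)}_{(𝐚,𝐜)} ∘ R^{(1,2)}_{(𝐚,𝐛)} and R^{(1,2)}_{(𝐚,𝐛)} ∘ R^{(1,3)}_{(𝐚,𝐜)} ∘ R^{(2,3)}_{(𝐛,𝐜)} is nonzero, the two compositions give the same value. -/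
/-- `R` acting on factors (1,2) of `Y³` and as the identity on the third. -/
def act12 {Y : Type*} (R : Y × Y → Y × Y) : Y × Y × Y → Y × Y × Y :=
  fun p => ((R (p.1, p.2.1)).1, (R (p.1, p.2.1)).2, p.2.2)

/-- `R` acting on factors (1,3) of `Y³` and as the identity on the second. -/
def act13 {Y : Type*} (R : Y × Y → Y × Y) : Y × Y × Y → Y × Y × Y :=
  fun p => ((R (p.1, p.2.2)).1, p.2.1, (R (p.1, p.2.2)).2)

/-- `R` acting on factors (2,3) of `Y³` and as the identity on the first. -/
def act23 {Y : Type*} (R : Y × Y → Y × Y) : Y × Y × Y → Y × Y × Y :=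
  fun p => (p.1, (R (p.2.1, p.2.2)).1, (R (p.2.1, p.2.2)).2)

/-- Membership in the Jacobi quartic `E_k = {(a,A) : A² = a⁴ + k a² + 1}`. -/
def onJacobi (k : ℂ) (a : ℂ × ℂ) : Prop :=
  a.2 ^ 2 = a.1 ^ 4 + k * a.1 ^ 2 + 1

/-- The denominator of `F(x,y,z;𝐚,𝐛)` for the Krichever–Novikov map. -/
def denKN (x y z : ℂ) (a b : ℂ × ℂ) : ℂ :=
  (a.1 * b.2 - b.1 * a.2) * (a.1 * b.1 * y * z - 1) * x +
    (1 - a.1 ^ 2 * b.1 ^ 2) * (a.1 * z - b.1 * y)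

/-- The function `F(x,y,z;𝐚,𝐛)` for the Krichever–Novikov map. -/
noncomputable def Fkn (x y z : ℂ) (a b : ℂ × ℂ) : ℂ :=
  ((1 - a.1 ^ 2 * b.1 ^ 2) * (b.1 * z - a.1 * y) * x +
      (a.1 * b.2 - b.1 * a.2) * (y * z - a.1 * b.1)) / denKN x y z a b

/-- The discrete Krichever–Novikov Yang–Baxter map
`R_{(𝐚,𝐛)}((x,X),(y,Y)) = ((F(y,x,Y;𝐚,𝐛), Y), (x, F(X,x,Y;𝐚,𝐛)))`. -/
noncomputable def Rkn (a b : ℂ × ℂ) : (ℂ × ℂ) × (ℂ × ℂ) → (ℂ × ℂ) × (ℂ × ℂ) :=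
  fun uv => ((Fkn uv.2.1 uv.1.1 uv.2.2 a b, uv.2.2),
             (uv.1.1, Fkn uv.1.2 uv.1.1 uv.2.2 a b))

/-- The denominators encountered in applying `Rkn a b` at a point are nonzero. -/
def okKN (a b : ℂ × ℂ) (uv : (ℂ × ℂ) × (ℂ × ℂ)) : Prop :=
  denKN uv.2.1 uv.1.1 uv.2.2 a b ≠ 0 ∧ denKN uv.1.2 uv.1.1 uv.2.2 a b ≠ 0

theorem kn_r1 (k a b c A B C : ℂ) (ha : A ^ 2 = a ^ 4 + k * a ^ 2 + 1)
    (hb : B ^ 2 = b ^ 4 + k * b ^ 2 + 1) (hc : C ^ 2 = c ^ 4 + k * c ^ 2 + 1) :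
    - a * b * c * (a * B - b * A) * (b * C - c * B) * (a * C - c * A) + a * (b * C - c * B) * (1 - a ^ 2 * b ^ 2) * (1 - a ^ 2 * c ^ 2) - b * (a * C - c * A) * (1 - a ^ 2 * b ^ 2) * (1 - b ^ 2 * c ^ 2) + c * (a * B - b * A) * (1 - b ^ 2 * c ^ 2) * (1 - a ^ 2 * c ^ 2) = 0 := by
  linear_combination (- a * b ^ 3 * c ^ 2 * C + a * b ^ 2 * c ^ 3 * B) * ha +
    (a ^ 3 * b * c ^ 2 * C - a ^ 2 * b * c ^ 3 * A) * hb +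
    (- a ^ 3 * b ^ 2 * c * B + a ^ 2 * b ^ 3 * c * A) * hc

theorem kn_r2 (k a b c A B C : ℂ) (ha : A ^ 2 = a ^ 4 + k * a ^ 2 + 1)
    (hb : B ^ 2 = b ^ 4 + k * b ^ 2 + 1) (hc : C ^ 2 = c ^ 4 + k * c ^ 2 + 1) :
    a * b * (a * B - b * A) * (1 - b ^ 2 * c ^ 2) * (1 - a ^ 2 * c ^ 2) - a * c * (a * C - c * A) * (1 - a ^ 2 * b ^ 2) * (1 - b ^ 2 * c ^ 2) + b * c * (b * C - c * B) * (1 - a ^ 2 * b ^ 2) * (1 - a ^ 2 * c ^ 2) - (a * B - b * A) * (b * C - c * B) * (a * C - c * A) = 0 := by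
  linear_combination (- b ^ 2 * c * C + b * c ^ 2 * B) * ha +
    (a ^ 2 * c * C - a * c ^ 2 * A) * hb +
    (- a ^ 2 * b * B + a * b ^ 2 * A) * hc

theorem kn_k0 (k a b c A B C : ℂ) (ha : A ^ 2 = a ^ 4 + k * a ^ 2 + 1)
    (hb : B ^ 2 = b ^ 4 + k * b ^ 2 + 1) (hc : C ^ 2 = c ^ 4 + k * c ^ 2 + 1) :
    a ^ 2 * b * (a * B - b * A) * (b * C - c * B) * (1 - a ^ 2 * c ^ 2) + a ^ 2 * c * (b * C - c * B) * (a * C - c * A) * (1 - a ^ 2 * b ^ 2) - a * b ^ 2 * (a * B - b * A) * (a * C - c * A) * (1 - b ^ 2 * c ^ 2)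
      + a * c ^ 2 * (a * B - b * A) * (a * C - c * A) * (1 - b ^ 2 * c ^ 2) - b ^ 2 * c * (b * C - c * B) * (a * C - c * A) * (1 - a ^ 2 * b ^ 2) - b * c ^ 2 * (a * B - b * A) * (b * C - c * B) * (1 - a ^ 2 * c ^ 2)
      - 2 * b * c * A * (a * B - b * A) * (b * C - c * B) * (a * C - c * A) = 0 := by
  linear_combination (a * b ^ 5 * c ^ 3 - a * b ^ 3 * c ^ 5 + 2 * a * b ^ 3 * c * C ^ 2 - a * b ^ 3 * c
      - 2 * a * b * c ^ 3 * B ^ 2 + a * b * c ^ 3 - 2 * b ^ 3 * c ^ 2 * A * C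
      + 2 * b ^ 2 * c ^ 3 * A * B) * ha +
    (- a ^ 5 * b * c ^ 3 - a ^ 3 * b * c ^ 5 - 2 * a ^ 3 * b * c ^ 3 * k - a ^ 3 * b * c
      + 2 * a ^ 2 * b * c ^ 2 * A * C - a * b * c ^ 3) * hb +
    (a ^ 5 * b ^ 3 * c + a ^ 3 * b ^ 5 * c + 2 * a ^ 3 * b ^ 3 * c * k + a ^ 3 * b * c
      - 2 * a ^ 2 * b ^ 2 * c * A * B + a * b ^ 3 * c) * hc

theorem kn_k1 (k a b c A B C : ℂ) (ha : A ^ 2 = a ^ 4 + k * a ^ 2 + 1)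
    (hb : B ^ 2 = b ^ 4 + k * b ^ 2 + 1) (hc : C ^ 2 = c ^ 4 + k * c ^ 2 + 1) :
    - a ^ 2 * b * c ^ 2 * (a * B - b * A) * (a * C - c * A) * (1 - b ^ 2 * c ^ 2) - a ^ 2 * c * (1 - a ^ 2 * b ^ 2) * (1 - b ^ 2 * c ^ 2) * (1 - a ^ 2 * c ^ 2)
      + a * b ^ 2 * c ^ 2 * (a * B - b * A) * (b * C - c * B) * (1 - a ^ 2 * c ^ 2) - a * (a * B - b * A) * (b * C - c * B) * (1 - a ^ 2 * c ^ 2) + b ^ 2 * c * (1 - a ^ 2 * b ^ 2) * (1 - b ^ 2 * c ^ 2) * (1 - a ^ 2 * c ^ 2)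
      + 2 * b * c * A * (a * B - b * A) * (1 - b ^ 2 * c ^ 2) * (1 - a ^ 2 * c ^ 2) + b * (a * B - b * A) * (a * C - c * A) * (1 - b ^ 2 * c ^ 2) = 0 := by
  linear_combination (- a ^ 2 * b ^ 4 * c ^ 5 + a ^ 2 * b ^ 2 * c ^ 3 + b ^ 4 * c ^ 3 - b ^ 2 * c) * ha +
    (a ^ 4 * b ^ 2 * c ^ 5 - a ^ 4 * c ^ 3 - a ^ 2 * b ^ 2 * c ^ 3 + a ^ 2 * c) * hb +
    (0) * hc

theorem kn_k2 (k a b c A B C : ℂ) (ha : A ^ 2 = a ^ 4 + k * a ^ 2 + 1)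
    (hb : B ^ 2 = b ^ 4 + k * b ^ 2 + 1) (hc : C ^ 2 = c ^ 4 + k * c ^ 2 + 1) :
    - a ^ 2 * b ^ 2 * c * (a * B - b * A) * (b * C - c * B) * (1 - a ^ 2 * c ^ 2) - a ^ 2 * b * c ^ 2 * (b * C - c * B) * (a * C - c * A) * (1 - a ^ 2 * b ^ 2)
      - a * b ^ 2 * (1 - a ^ 2 * b ^ 2) * (1 - b ^ 2 * c ^ 2) * (1 - a ^ 2 * c ^ 2) + a * c ^ 2 * (1 - a ^ 2 * b ^ 2) * (1 - b ^ 2 * c ^ 2) * (1 - a ^ 2 * c ^ 2) + 2 * b * c * A * (b * C - c * B) * (1 - a ^ 2 * b ^ 2) * (1 - a ^ 2 * c ^ 2)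
      + b * (b * C - c * B) * (a * C - c * A) * (1 - a ^ 2 * b ^ 2) + c * (a * B - b * A) * (b * C - c * B) * (1 - a ^ 2 * c ^ 2) = 0 := by
  linear_combination (0) * ha +
    (- a ^ 5 * b ^ 2 * c ^ 4 + a ^ 3 * b ^ 2 * c ^ 2 + a ^ 3 * c ^ 4 - a * c ^ 2) * hb +
    (a ^ 5 * b ^ 4 * c ^ 2 - a ^ 3 * b ^ 4 - a ^ 3 * b ^ 2 * c ^ 2 + a * b ^ 2) * hc

theorem kn_k3 (k a b c A B C : ℂ) (ha : A ^ 2 = a ^ 4 + k * a ^ 2 + 1)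
    (hb : B ^ 2 = b ^ 4 + k * b ^ 2 + 1) (hc : C ^ 2 = c ^ 4 + k * c ^ 2 + 1) :
    a ^ 2 * b ^ 2 * c * (a * B - b * A) * (a * C - c * A) * (1 - b ^ 2 * c ^ 2) + a ^ 2 * b * (1 - a ^ 2 * b ^ 2) * (1 - b ^ 2 * c ^ 2) * (1 - a ^ 2 * c ^ 2)
      + a * b ^ 2 * c ^ 2 * (b * C - c * B) * (a * C - c * A) * (1 - a ^ 2 * b ^ 2) - a * (b * C - c * B) * (a * C - c * A) * (1 - a ^ 2 * b ^ 2) - b * c ^ 2 * (1 - a ^ 2 * b ^ 2) * (1 - b ^ 2 * c ^ 2) * (1 - a ^ 2 * c ^ 2)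
      - 2 * b * c * A * (a * C - c * A) * (1 - a ^ 2 * b ^ 2) * (1 - b ^ 2 * c ^ 2) - c * (a * B - b * A) * (a * C - c * A) * (1 - b ^ 2 * c ^ 2) = 0 := by
  linear_combination (a ^ 2 * b ^ 5 * c ^ 4 - a ^ 2 * b ^ 3 * c ^ 2 - b ^ 3 * c ^ 4 + b * c ^ 2) * ha +
    (0) * hb +
    (- a ^ 4 * b ^ 5 * c ^ 2 + a ^ 4 * b ^ 3 + a ^ 2 * b ^ 3 * c ^ 2 - a ^ 2 * b) * hc

theorem kn_tetra (a b c l1 l2 l3 e1 e2 e3 x y Y Z p W V : ℂ)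
    (r1 : - a * b * c * l1 * l2 * l3 + a * l2 * e1 * e3 - b * l3 * e1 * e2 + c * l1 * e2 * e3 = 0)
    (r2 : a * b * l1 * e2 * e3 - a * c * l3 * e1 * e2 + b * c * l2 * e1 * e3 - l1 * l2 * l3 = 0)
    (hp : (l1 * (a * b * x * Y - 1) * y + e1 * (a * Y - b * x)) ≠ 0)
    (hV : (l2 * (b * c * y * Z - 1) * Y + e2 * (b * Z - c * y)) ≠ 0)
    (hW : (l3 * (a * c * p * Z - 1) * Y + e3 * (a * Z - c * p)) ≠ 0)
    (ep : p * (l1 * (a * b * x * Y - 1) * y + e1 * (a * Y - b * x)) = (e1 * (b * Y - a * x) * y + l1 * (x * Y - a * b)))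
    (eV : V * (l2 * (b * c * y * Z - 1) * Y + e2 * (b * Z - c * y)) = (e2 * (c * Z - b * y) * Y + l2 * (y * Z - b * c)))
    (eW : W * (l3 * (a * c * p * Z - 1) * Y + e3 * (a * Z - c * p)) = (e3 * (c * Z - a * p) * Y + l3 * (p * Z - a * c))) :
    l1 * e2 * e3 * (x * Y + W * V) + l2 * e1 * e3 * (x * W + Y * V)
      - l3 * e1 * e2 * (x * V + Y * W) - l1 * l2 * l3 * (1 + x * Y * W * V) = 0 := by
  have key : (l1 * (a * b * x * Y - 1) * y + e1 * (a * Y - b * x)) * ((l2 * (b * c * y * Z - 1) * Y + e2 * (b * Z - c * y)) * ((l3 * (a * c * p * Z - 1) * Y + e3 * (a * Z - c * p)) * (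
      l1 * e2 * e3 * (x * Y + W * V) + l2 * e1 * e3 * (x * W + Y * V)
      - l3 * e1 * e2 * (x * V + Y * W) - l1 * l2 * l3 * (1 + x * Y * W * V)))) = 0 := by
    linear_combination (x ^ 2 * y ^ 2 * Y ^ 3 * a * b * l1 * l3 * e2
      + x ^ 2 * y ^ 2 * Y ^ 2 * Z * a * b * c * l2 * e1 * e3
      - x ^ 2 * y ^ 2 * Y ^ 2 * Z * a * l1 * l2 * l3 - x ^ 2 * y ^ 2 * Y * a * c * e1 * e2 * e3
      - x ^ 2 * y * Y ^ 3 * Z * a * c * l1 * l3 * e2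
      - x ^ 2 * y * Y ^ 3 * Z * b * c * l1 * l2 * e3
      + x ^ 2 * y * Y ^ 2 * a * b * c * l1 * l2 * l3 - x ^ 2 * y * Y ^ 2 * a * l2 * e1 * e3
      - x ^ 2 * y * Y ^ 2 * b * l3 * e1 * e2 + x ^ 2 * y * Y ^ 2 * c * l1 * e2 * e3
      + x ^ 2 * y * Y * Z * a * b * e1 * e2 * e3 + x ^ 2 * y * Y * Z * l2 * l3 * e1
      + x ^ 2 * Y ^ 3 * l1 * l2 * e3 - x ^ 2 * Y ^ 2 * Z * b * l1 * e2 * e3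
      + x ^ 2 * Y ^ 2 * Z * c * l3 * e1 * e2 - x ^ 2 * Y * b * c * l2 * l3 * e1
      - x * y ^ 2 * Y ^ 3 * Z * a * b * c * l3 * e1 * e2
      - x * y ^ 2 * Y ^ 3 * Z * b * l1 * l2 * l3
      + x * y ^ 2 * Y ^ 2 * Z ^ 2 * a * b * l1 * l2 * e3
      - x * y ^ 2 * Y ^ 2 * Z ^ 2 * a * c * l2 * l3 * e1
      + x * y ^ 2 * Y ^ 2 * b * c * e1 * e2 * e3 - x * y ^ 2 * Y ^ 2 * l1 * l3 * e2
      + x * y ^ 2 * Y * Z * a * l1 * e2 * e3 + x * y ^ 2 * Y * Z * c * l2 * e1 * e3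
      + x * y * Y ^ 3 * Z ^ 2 * a * b * c * l1 * e2 * e3
      + x * y * Y ^ 3 * Z ^ 2 * c * l1 * l2 * l3 + x * y * Y ^ 3 * a * l3 * e1 * e2
      + x * y * Y ^ 3 * b * l2 * e1 * e3 - x * y * Y * Z ^ 2 * a * l3 * e1 * e2
      - x * y * Y * Z ^ 2 * b * l2 * e1 * e3 - x * y * Y * a * b * c * l1 * e2 * e3
      - x * y * Y * c * l1 * l2 * l3 - x * Y ^ 3 * Z * a * l1 * e2 * e3
      - x * Y ^ 3 * Z * c * l2 * e1 * e3 - x * Y ^ 2 * Z ^ 2 * b * c * e1 * e2 * e3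
      + x * Y ^ 2 * Z ^ 2 * l1 * l3 * e2 - x * Y ^ 2 * a * b * l1 * l2 * e3
      + x * Y ^ 2 * a * c * l2 * l3 * e1 + x * Y * Z * a * b * c * l3 * e1 * e2
      + x * Y * Z * b * l1 * l2 * l3 + y ^ 2 * Y ^ 3 * Z ^ 2 * b * c * l2 * l3 * e1
      + y ^ 2 * Y ^ 2 * Z * b * l1 * e2 * e3 - y ^ 2 * Y ^ 2 * Z * c * l3 * e1 * e2
      - y ^ 2 * Y * Z ^ 2 * l1 * l2 * e3 - y * Y ^ 3 * Z * a * b * e1 * e2 * e3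
      - y * Y ^ 3 * Z * l2 * l3 * e1 - y * Y ^ 2 * Z ^ 2 * a * b * c * l1 * l2 * l3
      + y * Y ^ 2 * Z ^ 2 * a * l2 * e1 * e3 + y * Y ^ 2 * Z ^ 2 * b * l3 * e1 * e2
      - y * Y ^ 2 * Z ^ 2 * c * l1 * e2 * e3 + y * Y * Z * a * c * l1 * l3 * e2
      + y * Y * Z * b * c * l1 * l2 * e3 + Y ^ 3 * Z ^ 2 * a * c * e1 * e2 * e3
      - Y ^ 2 * Z * a * b * c * l2 * e1 * e3 + Y ^ 2 * Z * a * l1 * l2 * l3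
      - Y * Z ^ 2 * a * b * l1 * l3 * e2) * r1 +
      (x ^ 2 * y ^ 2 * Y ^ 3 * Z ^ 2 * a * b * c * l1 * l2 * e3
      + x ^ 2 * y ^ 2 * Y ^ 2 * Z * a * b * l3 * e1 * e2
      - x ^ 2 * y ^ 2 * Y ^ 2 * Z * a * c * l1 * e2 * e3
      - x ^ 2 * y ^ 2 * Y * Z ^ 2 * a * l2 * l3 * e1 - x ^ 2 * y * Y ^ 3 * Z * a * l1 * l2 * e3
      - x ^ 2 * y * Y ^ 3 * Z * b * l1 * l3 * e2
      + x ^ 2 * y * Y ^ 2 * Z ^ 2 * a * b * l1 * e2 * e3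
      - x ^ 2 * y * Y ^ 2 * Z ^ 2 * a * c * l3 * e1 * e2
      - x ^ 2 * y * Y ^ 2 * Z ^ 2 * b * c * l2 * e1 * e3
      + x ^ 2 * y * Y ^ 2 * Z ^ 2 * l1 * l2 * l3 + x ^ 2 * y * Y * Z * a * b * c * l2 * l3 * e1
      + x ^ 2 * y * Y * Z * c * e1 * e2 * e3 + x ^ 2 * Y ^ 3 * Z ^ 2 * c * l1 * l3 * e2
      - x ^ 2 * Y ^ 2 * Z * b * c * l1 * l2 * l3 + x ^ 2 * Y ^ 2 * Z * l2 * e1 * e3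
      - x ^ 2 * Y * Z ^ 2 * b * e1 * e2 * e3 - x * y ^ 2 * Y ^ 3 * Z * a * b * l2 * e1 * e3
      - x * y ^ 2 * Y ^ 3 * Z * b * c * l1 * e2 * e3
      + x * y ^ 2 * Y ^ 2 * Z ^ 2 * b * l2 * l3 * e1
      - x * y ^ 2 * Y ^ 2 * Z ^ 2 * c * l1 * l2 * e3
      + x * y ^ 2 * Y ^ 2 * a * b * c * l1 * l3 * e2 - x * y ^ 2 * Y ^ 2 * a * e1 * e2 * e3
      + x * y ^ 2 * Y * Z * a * c * l1 * l2 * l3 + x * y ^ 2 * Y * Z * l3 * e1 * e2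
      + x * y * Y ^ 3 * Z ^ 2 * a * c * l2 * e1 * e3
      + x * y * Y ^ 3 * Z ^ 2 * b * c * l3 * e1 * e2 + x * y * Y ^ 3 * a * b * l1 * l2 * l3
      + x * y * Y ^ 3 * l1 * e2 * e3 - x * y * Y * Z ^ 2 * a * b * l1 * l2 * l3
      - x * y * Y * Z ^ 2 * l1 * e2 * e3 - x * y * Y * a * c * l2 * e1 * e3
      - x * y * Y * b * c * l3 * e1 * e2 - x * Y ^ 3 * Z * a * c * l1 * l2 * l3
      - x * Y ^ 3 * Z * l3 * e1 * e2 - x * Y ^ 2 * Z ^ 2 * a * b * c * l1 * l3 * e2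
      + x * Y ^ 2 * Z ^ 2 * a * e1 * e2 * e3 - x * Y ^ 2 * b * l2 * l3 * e1
      + x * Y ^ 2 * c * l1 * l2 * e3 + x * Y * Z * a * b * l2 * e1 * e3
      + x * Y * Z * b * c * l1 * e2 * e3 + y ^ 2 * Y ^ 3 * b * e1 * e2 * e3
      + y ^ 2 * Y ^ 2 * Z * b * c * l1 * l2 * l3 - y ^ 2 * Y ^ 2 * Z * l2 * e1 * e3
      - y ^ 2 * Y * c * l1 * l3 * e2 - y * Y ^ 3 * Z * a * b * c * l2 * l3 * e1
      - y * Y ^ 3 * Z * c * e1 * e2 * e3 - y * Y ^ 2 * a * b * l1 * e2 * e3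
      + y * Y ^ 2 * a * c * l3 * e1 * e2 + y * Y ^ 2 * b * c * l2 * e1 * e3
      - y * Y ^ 2 * l1 * l2 * l3 + y * Y * Z * a * l1 * l2 * e3 + y * Y * Z * b * l1 * l3 * e2
      + Y ^ 3 * a * l2 * l3 * e1 - Y ^ 2 * Z * a * b * l3 * e1 * e2
      + Y ^ 2 * Z * a * c * l1 * e2 * e3 - Y * a * b * c * l1 * l2 * e3) * r2 +
      (l1 * (a * b * x * Y - 1) * y + e1 * (a * Y - b * x)) * (l3 * (a * c * p * Z - 1) * Y + e3 * (a * Z - c * p)) * ((- x * l3 * e1 * e2 + Y * l2 * e1 * e3) + (- x * Y * l1 * l2 * l3 + l1 * e2 * e3) * W) * eV +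
      (l1 * (a * b * x * Y - 1) * y + e1 * (a * Y - b * x)) * ((x * l2 * e1 * e3 - Y * l3 * e1 * e2) * (l2 * (b * c * y * Z - 1) * Y + e2 * (b * Z - c * y)) + (- x * Y * l1 * l2 * l3 + l1 * e2 * e3) * (e2 * (c * Z - b * y) * Y + l2 * (y * Z - b * c))) * eW +
      (((x * Y * l1 * e2 * e3 - l1 * l2 * l3) * (l2 * (b * c * y * Z - 1) * Y + e2 * (b * Z - c * y)) + (- x * l3 * e1 * e2 + Y * l2 * e1 * e3) * (e2 * (c * Z - b * y) * Y + l2 * (y * Z - b * c))) * (Y * Z * a * c * l3 - c * e3)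
        + ((x * l2 * e1 * e3 - Y * l3 * e1 * e2) * (l2 * (b * c * y * Z - 1) * Y + e2 * (b * Z - c * y)) + (- x * Y * l1 * l2 * l3 + l1 * e2 * e3) * (e2 * (c * Z - b * y) * Y + l2 * (y * Z - b * c))) * (- Y * a * e3 + Z * l3)) * ep
  exact (((mul_eq_zero.mp key).resolve_left hp |> mul_eq_zero.mp).resolve_left hV
    |> mul_eq_zero.mp).resolve_left hW

theorem kn_mobius (a b c A l1 l2 l3 e1 e2 e3 x X Y W V p : ℂ)
    (r1 : - a * b * c * l1 * l2 * l3 + a * l2 * e1 * e3 - b * l3 * e1 * e2 + c * l1 * e2 * e3 = 0)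
    (r2 : a * b * l1 * e2 * e3 - a * c * l3 * e1 * e2 + b * c * l2 * e1 * e3 - l1 * l2 * l3 = 0)
    (k0 : a ^ 2 * b * l1 * l2 * e3 + a ^ 2 * c * l2 * l3 * e1 - a * b ^ 2 * l1 * l3 * e2
      + a * c ^ 2 * l1 * l3 * e2 - b ^ 2 * c * l2 * l3 * e1 - b * c ^ 2 * l1 * l2 * e3
      - 2 * b * c * A * l1 * l2 * l3 = 0)
    (k1 : - a ^ 2 * b * c ^ 2 * l1 * l3 * e2 - a ^ 2 * c * e1 * e2 * e3
      + a * b ^ 2 * c ^ 2 * l1 * l2 * e3 - a * l1 * l2 * e3 + b ^ 2 * c * e1 * e2 * e3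
      + 2 * b * c * A * l1 * e2 * e3 + b * l1 * l3 * e2 = 0)
    (k2 : - a ^ 2 * b ^ 2 * c * l1 * l2 * e3 - a ^ 2 * b * c ^ 2 * l2 * l3 * e1
      - a * b ^ 2 * e1 * e2 * e3 + a * c ^ 2 * e1 * e2 * e3 + 2 * b * c * A * l2 * e1 * e3
      + b * l2 * l3 * e1 + c * l1 * l2 * e3 = 0)
    (k3 : a ^ 2 * b ^ 2 * c * l1 * l3 * e2 + a ^ 2 * b * e1 * e2 * e3
      + a * b ^ 2 * c ^ 2 * l2 * l3 * e1 - a * l2 * l3 * e1 - b * c ^ 2 * e1 * e2 * e3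
      - 2 * b * c * A * l3 * e1 * e2 - c * l1 * l3 * e2 = 0)
    (hX : (l1 * (a * b * x * Y - 1) * X + e1 * (a * Y - b * x)) ≠ 0)
    (eX : p * (l1 * (a * b * x * Y - 1) * X + e1 * (a * Y - b * x)) = (e1 * (b * Y - a * x) * X + l1 * (x * Y - a * b)))
    (t : l1 * e2 * e3 * (x * Y + W * V) + l2 * e1 * e3 * (x * W + Y * V)
      - l3 * e1 * e2 * (x * V + Y * W) - l1 * l2 * l3 * (1 + x * Y * W * V) = 0) :
    (e2 * (c * W - b * x) * p + l2 * (x * W - b * c)) * (l3 * (a * c * x * V - 1) * X + e3 * (a * V - c * x))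
      = (e3 * (c * V - a * x) * X + l3 * (x * V - a * c)) * (l2 * (b * c * x * W - 1) * p + e2 * (b * W - c * x)) := by
  have key : (l1 * (a * b * x * Y - 1) * X + e1 * (a * Y - b * x)) * ((e2 * (c * W - b * x) * p + l2 * (x * W - b * c)) * (l3 * (a * c * x * V - 1) * X + e3 * (a * V - c * x))
      - (e3 * (c * V - a * x) * X + l3 * (x * V - a * c)) * (l2 * (b * c * x * W - 1) * p + e2 * (b * W - c * x))) = 0 := by
    linear_combination (- x ^ 2 * X ^ 2 * a ^ 2 * b * c + x ^ 2 * b * c - 2 * x * X * b * c * A + X ^ 2 * b * c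
      - a ^ 2 * b * c) * t + (x ^ 2 * X * W * a * b * c * l2 * e3 - x ^ 2 * X * V * a * b * c * l3 * e2
      - x ^ 2 * W * V * b * c * l2 * l3 + x ^ 2 * b * c * e2 * e3
      + x * X * W * V * a * c ^ 2 * l3 * e2 - x * X * W * V * b * c ^ 2 * l2 * e3
      - x * X * a * l2 * e3 + x * X * b * l3 * e2 + x * W * a * b * c ^ 2 * l2 * l3
      - x * W * c ^ 2 * e2 * e3 - x * V * a * b * e2 * e3 + x * V * l2 * l3
      - X * W * c * l3 * e2 + X * V * c * l2 * e3 + W * V * a * c * e2 * e3 - a * c * l2 * l3) * eX +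
      (x ^ 2 * Y * X ^ 2 * V * a * b * c - x ^ 2 * Y * W * c + x ^ 2 * X ^ 2 * a
      - x ^ 2 * W * V * b - x * Y * X ^ 2 * b + x * Y * W * V * a - x * X ^ 2 * V * c
      + x * W * a * b * c) * r1 +
      (x ^ 2 * Y * X ^ 2 * W * a * b - x ^ 2 * Y * V + x ^ 2 * X ^ 2 * W * V * a * c
      - x ^ 2 * b * c - x * Y * X ^ 2 * W * V * b * c + x * Y * a * c - x * X ^ 2 * W
      + x * V * a * b) * r2 +
      (x ^ 2 * Y * X * W * V + x * X) * k0 +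
      (x ^ 2 * Y * X + x * X * W * V) * k1 +
      (x ^ 2 * X * W + x * Y * X * V) * k2 +
      (x ^ 2 * X * V + x * Y * X * W) * k3
  exact sub_eq_zero.mp ((mul_eq_zero.mp key).resolve_left hX)

/-- The central identity: all components of the Yang–Baxter equation are instances of it. -/
theorem kn_core (k : ℂ) (a b c : ℂ × ℂ)
    (ha : onJacobi k a) (hb : onJacobi k b) (hc : onJacobi k c) (x X y Y Z : ℂ)
    (d1 : denKN y x Y a b ≠ 0) (d2 : denKN Y (Fkn y x Y a b) Z a c ≠ 0)
    (d3 : denKN Y y Z b c ≠ 0) (d4 : denKN X x Y a b ≠ 0)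
    (d5 : denKN (Fkn X x Y a b) x (Fkn Y (Fkn y x Y a b) Z a c) b c ≠ 0)
    (d6 : denKN X x (Fkn Y y Z b c) a c ≠ 0) :
    Fkn (Fkn X x Y a b) x (Fkn Y (Fkn y x Y a b) Z a c) b c = Fkn X x (Fkn Y y Z b c) a c := by
  have ep : Fkn y x Y a b * denKN y x Y a b = _ := div_mul_cancel₀ _ d1
  have eW : Fkn Y (Fkn y x Y a b) Z a c * denKN Y (Fkn y x Y a b) Z a c = _ :=
    div_mul_cancel₀ _ d2
  have eV : Fkn Y y Z b c * denKN Y y Z b c = _ := div_mul_cancel₀ _ d3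
  have eX : Fkn X x Y a b * denKN X x Y a b = _ := div_mul_cancel₀ _ d4
  generalize Fkn Y (Fkn y x Y a b) Z a c = W at *
  generalize Fkn y x Y a b = p at *
  generalize Fkn Y y Z b c = V at *
  generalize Fkn X x Y a b = q at *
  obtain ⟨a, A⟩ := a
  obtain ⟨b, B⟩ := b
  obtain ⟨c, C⟩ := c
  have t := kn_tetra a b c _ _ _ _ _ _ x y Y Z p W V (kn_r1 k a b c A B C ha hb hc)
    (kn_r2 k a b c A B C ha hb hc) d1 d3 d2 ep eV eW
  have m := kn_mobius a b c A _ _ _ _ _ _ x X Y W V q (kn_r1 k a b c A B C ha hb hc)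
    (kn_r2 k a b c A B C ha hb hc) (kn_k0 k a b c A B C ha hb hc)
    (kn_k1 k a b c A B C ha hb hc) (kn_k2 k a b c A B C ha hb hc)
    (kn_k3 k a b c A B C ha hb hc) d4 eX t
  exact (div_eq_div_iff d5 d6).mpr m

theorem denKN_swap (x y z : ℂ) (a b : ℂ × ℂ) : denKN x z y b a = -denKN x y z a b := by
  simp only [denKN]; ring

theorem Fkn_swap (x y z : ℂ) (a b : ℂ × ℂ) : Fkn x z y b a = Fkn x y z a b := by
  simp only [Fkn]
  rw [denKN_swap, div_neg, ← neg_div]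
  congr 1
  ring

/-- The central identity read along the reversed staircase. -/
theorem kn_core_rev (k : ℂ) (a b c : ℂ × ℂ)
    (ha : onJacobi k a) (hb : onJacobi k b) (hc : onJacobi k c) (x z y Y Z : ℂ)
    (d1 : denKN Y y Z b c ≠ 0) (d2 : denKN y x (Fkn Y y Z b c) a c ≠ 0)
    (d3 : denKN y x Y a b ≠ 0) (d4 : denKN z y Z b c ≠ 0)
    (d5 : denKN (Fkn z y Z b c) (Fkn y x (Fkn Y y Z b c) a c) Z a b ≠ 0)
    (d6 : denKN z (Fkn y x Y a b) Z a c ≠ 0) :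
    Fkn (Fkn z y Z b c) (Fkn y x (Fkn Y y Z b c) a c) Z a b = Fkn z (Fkn y x Y a b) Z a c := by
  have h := kn_core k c b a hc hb ha Z z Y y x
  simp only [Fkn_swap _ _ _ b c, Fkn_swap _ _ _ a c, Fkn_swap _ _ _ a b,
    denKN_swap _ _ _ b c, denKN_swap _ _ _ a c, denKN_swap _ _ _ a b, ne_eq, neg_eq_zero] at h
  exact h d1 d2 d3 d4 d5 d6

/-- The discrete Krichever–Novikov Yang–Baxter map satisfies the parametric
Yang–Baxter equation, for parameters on the Jacobi quartic, wherever all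
denominators encountered in both compositions are nonzero. -/
theorem Rkn_yangBaxter (k : ℂ) (a b c : ℂ × ℂ)
    (ha : onJacobi k a) (hb : onJacobi k b) (hc : onJacobi k c)
    (u₁ u₂ u₃ : ℂ × ℂ)
    (p1 p2 q1 q2 : (ℂ × ℂ) × (ℂ × ℂ) × (ℂ × ℂ))
    (hp1 : p1 = act12 (Rkn a b) (u₁, u₂, u₃))
    (hp2 : p2 = act13 (Rkn a c) p1)
    (hq1 : q1 = act23 (Rkn b c) (u₁, u₂, u₃))
    (hq2 : q2 = act13 (Rkn a c) q1)
    (h1 : okKN a b (u₁, u₂))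
    (h2 : okKN a c (p1.1, p1.2.2))
    (h3 : okKN b c (p2.2.1, p2.2.2))
    (h4 : okKN b c (u₂, u₃))
    (h5 : okKN a c (q1.1, q1.2.2))
    (h6 : okKN a b (q2.1, q2.2.1)) :
    act23 (Rkn b c) p2 = act12 (Rkn a b) q2 := by
  subst hp1 hq1
  subst hp2 hq2
  obtain ⟨x, X⟩ := u₁
  obtain ⟨y, Y⟩ := u₂
  obtain ⟨z, Z⟩ := u₃
  simp only [act12, act13, act23, Rkn, okKN] at *
  obtain ⟨h1, g1⟩ := h1
  obtain ⟨h2, g2⟩ := h2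
  obtain ⟨h3, g3⟩ := h3
  obtain ⟨h4, g4⟩ := h4
  obtain ⟨h5, g5⟩ := h5
  obtain ⟨h6, g6⟩ := h6
  have e2 := kn_core k a b c ha hb hc x y y Y Z h1 g2 g4 h1 h3 h5
  have e4 := kn_core k a b c ha hb hc x X y Y Z h1 g2 g4 g1 g3 g5
  have e1 := kn_core_rev k a b c ha hb hc x z y Y Z g4 h5 h1 h4 h6 h2
  have e3 := kn_core_rev k a b c ha hb hc x Y y Y Z g4 h5 h1 g4 g6 g2
  rw [e1, e2, e3, e4]
end

section
/- Lax factorization for the Krichever–Novikov Yang–Baxter map: fix k ∈ ℂ, points 𝐚 = (a,A), 𝐛 = (b,B) on E_k = {(a,A) ∈ ℂ² : A² = a⁴ + k a² + 1}, and (x,X), (y,Y) ∈ ℂ² such that the denominators in F(y,x,Y;𝐚,𝐛) and F(X,x,Y;𝐚,𝐛) are nonzero; set p = F(y,x,Y;𝐚,𝐛), P = Y, q = x, Q = F(X,x,Y;𝐚,𝐛) and assume ρ((x,X);𝐚), ρ((y,Y);𝐛), ρ((p,P);𝐚), ρ((q,Q);𝐛) are all nonzero. Then there exists μ ∈ ℂ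 such that μ² · ρ((p,P);𝐚) · ρ((q,Q);𝐛) = ρ((x,X);𝐚) · ρ((y,Y);𝐛), and for every point (λ,Λ) ∈ E_k with 1 − a²λ² ≠ 0 and 1 − b²λ² ≠ 0, the 2×2 complex matrices satisfy W((y,Y);𝐛,(λ,Λ)) · W((x,X);𝐚,(λ,Λ)) = μ · W((p,P);𝐚,(λ,Λ)) · W((q,Q);𝐛,(λ,Λ)). -/
/-- The Krichever–Novikov Lax matrix `W((x,X); 𝐚, 𝛌)`. -/
noncomputable def Wkn (u a lam : ℂ × ℂ) : Matrix (Fin 2) (Fin 2) ℂ :=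
  let D := (a.1 * lam.2 - a.2 * lam.1) / (1 - a.1 ^ 2 * lam.1 ^ 2)
  !![-lam.1 * u.2 - u.1 * D, a.1 * (1 + lam.1 * u.1 * u.2 * D);
     -a.1 * (u.1 * u.2 + lam.1 * D), lam.1 * u.1 + u.2 * D]

/-- The scalar `ρ((x,X);𝐚) = (x²X² + 1)a² − x² − X² + 2AxX`. -/
def rhoKN (u a : ℂ × ℂ) : ℂ :=
  (u.1 ^ 2 * u.2 ^ 2 + 1) * a.1 ^ 2 - u.1 ^ 2 - u.2 ^ 2 + 2 * a.2 * u.1 * u.2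

/-- The symmetric biquadratic `H(x,Y)` governing the factorization. -/
def HKN (k a A b B x Y : ℂ) : ℂ :=
  (1 - a ^ 2 * b ^ 2) ^ 2 * (x ^ 2 + Y ^ 2)
    - ((a ^ 2 + b ^ 2) * (1 + a ^ 2 * b ^ 2) + 2 * k * a ^ 2 * b ^ 2 - 2 * a * b * A * B)
      * (x ^ 2 * Y ^ 2 + 1)
    + x * Y * (4 * a * b * (a ^ 2 + b ^ 2) + 2 * (1 + a ^ 2 * b ^ 2) * (k * a * b - A * B))

theorem KN_D (k a A b B x Y : ℂ) (ha : A ^ 2 = a ^ 4 + k * a ^ 2 + 1)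
    (hb : B ^ 2 = b ^ 4 + k * b ^ 2 + 1) (s T : ℂ) (hs : s = 1 - a ^ 2 * b ^ 2)
    (hT : T = a * B - b * A) :
    s ^ 2 * (b * Y - a * x) * (a * Y - b * x) - T ^ 2 * (x * Y - a * b) * (a * b * x * Y - 1) =
      a * b * HKN k a A b B x Y := by
  subst_vars
  unfold HKN
  linear_combination (a ^ 2 * b ^ 4 * x * Y - a * b ^ 3 * x ^ 2 * Y ^ 2 - a * b ^ 3 + b ^ 2 * x * Y) * ha
    + (a ^ 4 * b ^ 2 * x * Y - a ^ 3 * b * x ^ 2 * Y ^ 2 - a ^ 3 * b + a ^ 2 * x * Y) * hb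

theorem KN_rho1 (k a A b B x y Y : ℂ) (ha : A ^ 2 = a ^ 4 + k * a ^ 2 + 1)
    (hb : B ^ 2 = b ^ 4 + k * b ^ 2 + 1) (s T n d : ℂ) (hs : s = 1 - a ^ 2 * b ^ 2)
    (hT : T = a * B - b * A)
    (hn : n = s * (b * Y - a * x) * y + T * (x * Y - a * b))
    (hd : d = T * (a * b * x * Y - 1) * y + s * (a * Y - b * x)) :
    (n ^ 2 * Y ^ 2 + d ^ 2) * a ^ 2 - n ^ 2 - Y ^ 2 * d ^ 2 + 2 * A * n * Y * d =
      a ^ 2 * HKN k a A b B x Y * ((y ^ 2 * Y ^ 2 + 1) * b ^ 2 - y ^ 2 - Y ^ 2 + 2 * B * y * Y) := by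
  subst_vars
  unfold HKN
  linear_combination (-a ^ 4 * b ^ 4 * x ^ 2 * y ^ 2 * Y ^ 2 - a ^ 4 * b ^ 4 * Y ^ 2 + 2 * a ^ 3 * b ^ 5 * x * y
      ^ 2 * Y ^ 3 + 2 * a ^ 3 * b ^ 5 * x * Y + 4 * a ^ 3 * b ^ 3 * B * x * y * Y ^ 2 - 2 *
      a ^ 2 * A * b ^ 4 * x * y * Y ^ 2 - a ^ 2 * b ^ 4 * x ^ 2 * y ^ 2 * Y ^ 4 - 2 * a ^ 2
      * b ^ 4 * x ^ 2 * Y ^ 2 - 2 * a ^ 2 * b ^ 4 * y ^ 2 * Y ^ 2 - a ^ 2 * b ^ 4 - 4 * a ^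
      2 * b ^ 2 * B * x ^ 2 * y * Y ^ 3 - 4 * a ^ 2 * b ^ 2 * B * y * Y + 2 * a ^ 2 * b ^ 2
      * x ^ 2 * y ^ 2 * Y ^ 2 + a ^ 2 * b ^ 2 * x ^ 2 * Y ^ 4 + a ^ 2 * b ^ 2 * y ^ 2 + 2 *
      a ^ 2 * b ^ 2 * Y ^ 2 + 2 * a * A * b ^ 3 * x ^ 2 * y * Y ^ 3 + 2 * a * A * b ^ 3 * y
      * Y + 4 * a * b * B * x * y * Y ^ 2 - 2 * a * b * x * y ^ 2 * Y - 2 * a * b * x * Y ^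
      3 - 2 * A * b ^ 2 * x * y * Y ^ 2 + b ^ 2 * x ^ 2 * Y ^ 2 + b ^ 2 * y ^ 2 * Y ^ 2) * ha
    + (a ^ 6 * b ^ 2 * x ^ 2 * y ^ 2 * Y ^ 2 + a ^ 6 * b ^ 2 * Y ^ 2 - 2 * a ^ 5 * b * x * y ^ 2 *
      Y - 2 * a ^ 5 * b * x * Y ^ 3 + 2 * a ^ 4 * A * b ^ 2 * x * y * Y ^ 2 - a ^ 4 * b ^ 2
      * x ^ 2 * y ^ 2 * Y ^ 4 - a ^ 4 * b ^ 2 + a ^ 4 * x ^ 2 * Y ^ 4 + a ^ 4 * y ^ 2 - 2 *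
      a ^ 3 * A * b * x ^ 2 * y * Y ^ 3 - 2 * a ^ 3 * A * b * y * Y + 2 * a ^ 3 * b * x * y
      ^ 2 * Y ^ 3 + 2 * a ^ 3 * b * x * Y + 2 * a ^ 2 * A * x * y * Y ^ 2 - a ^ 2 * x ^ 2 *
      Y ^ 2 - a ^ 2 * y ^ 2 * Y ^ 2) * hb

theorem KN_rho2 (k a A b B x X Y : ℂ) (ha : A ^ 2 = a ^ 4 + k * a ^ 2 + 1)
    (hb : B ^ 2 = b ^ 4 + k * b ^ 2 + 1) (s T n d : ℂ) (hs : s = 1 - a ^ 2 * b ^ 2)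
    (hT : T = a * B - b * A)
    (hn : n = s * (b * Y - a * x) * X + T * (x * Y - a * b))
    (hd : d = T * (a * b * x * Y - 1) * X + s * (a * Y - b * x)) :
    (x ^ 2 * n ^ 2 + d ^ 2) * b ^ 2 - x ^ 2 * d ^ 2 - n ^ 2 + 2 * B * x * n * d =
      b ^ 2 * HKN k a A b B x Y * ((x ^ 2 * X ^ 2 + 1) * a ^ 2 - x ^ 2 - X ^ 2 + 2 * A * x * X) := by
  subst_vars
  unfold HKN
  linear_combination (a ^ 2 * b ^ 6 * x ^ 2 * X ^ 2 * Y ^ 2 + a ^ 2 * b ^ 6 * x ^ 2 + 2 * a ^ 2 * b ^ 4 * B * x ^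
      2 * X * Y - a ^ 2 * b ^ 4 * x ^ 4 * X ^ 2 * Y ^ 2 - a ^ 2 * b ^ 4 - 2 * a * b ^ 5 * x
      ^ 3 * Y - 2 * a * b ^ 5 * x * X ^ 2 * Y - 2 * a * b ^ 3 * B * x ^ 3 * X * Y ^ 2 - 2 *
      a * b ^ 3 * B * x * X + 2 * a * b ^ 3 * x ^ 3 * X ^ 2 * Y + 2 * a * b ^ 3 * x * Y + b
      ^ 4 * x ^ 4 * Y ^ 2 + b ^ 4 * X ^ 2 + 2 * b ^ 2 * B * x ^ 2 * X * Y - b ^ 2 * x ^ 2 *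
      X ^ 2 - b ^ 2 * x ^ 2 * Y ^ 2) * ha
    + (2 * a ^ 5 * b ^ 3 * x ^ 3 * X ^ 2 * Y + 2 * a ^ 5 * b ^ 3 * x * Y - a ^ 4 * b ^ 4 * x ^ 2 *
      X ^ 2 * Y ^ 2 - a ^ 4 * b ^ 4 * x ^ 2 - 2 * a ^ 4 * b ^ 2 * B * x ^ 2 * X * Y - a ^ 4
      * b ^ 2 * x ^ 4 * X ^ 2 * Y ^ 2 - 2 * a ^ 4 * b ^ 2 * x ^ 2 * X ^ 2 - 2 * a ^ 4 * b ^
      2 * x ^ 2 * Y ^ 2 - a ^ 4 * b ^ 2 + 4 * a ^ 3 * A * b ^ 3 * x ^ 2 * X * Y + 2 * a ^ 3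
      * b * B * x ^ 3 * X * Y ^ 2 + 2 * a ^ 3 * b * B * x * X - 4 * a ^ 2 * A * b ^ 2 * x ^
      3 * X * Y ^ 2 - 4 * a ^ 2 * A * b ^ 2 * x * X + a ^ 2 * b ^ 2 * x ^ 4 * Y ^ 2 + 2 * a
      ^ 2 * b ^ 2 * x ^ 2 * X ^ 2 * Y ^ 2 + 2 * a ^ 2 * b ^ 2 * x ^ 2 + a ^ 2 * b ^ 2 * X ^
      2 - 2 * a ^ 2 * B * x ^ 2 * X * Y + a ^ 2 * x ^ 2 * X ^ 2 + a ^ 2 * x ^ 2 * Y ^ 2 + 4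
      * a * A * b * x ^ 2 * X * Y - 2 * a * b * x ^ 3 * Y - 2 * a * b * x * X ^ 2 * Y) * hb

set_option maxHeartbeats 4000000 in
/-- The polynomial form of the factorization, entry by entry. -/
theorem KN_entries (k a A b B l L x X y Y : ℂ) (ha : A ^ 2 = a ^ 4 + k * a ^ 2 + 1)
    (hb : B ^ 2 = b ^ 4 + k * b ^ 2 + 1) (hl : L ^ 2 = l ^ 4 + k * l ^ 2 + 1)
    (s T u v d e α β γ δ D n1 d1 n2 d2 : ℂ) (hs : s = 1 - a ^ 2 * b ^ 2) (hT : T = a * B - b * A)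
    (hu : u = a * L - A * l) (hv : v = b * L - B * l)
    (hd : d = 1 - a ^ 2 * l ^ 2) (he : e = 1 - b ^ 2 * l ^ 2)
    (hα : α = s * (b * Y - a * x)) (hβ : β = x * Y - a * b) (hγ : γ = a * b * x * Y - 1)
    (hδ : δ = s * (a * Y - b * x)) (hD : D = α * δ - T ^ 2 * (β * γ))
    (hn1 : n1 = α * y + T * β) (hd1 : d1 = T * γ * y + δ)
    (hn2 : n2 = α * X + T * β) (hd2 : d2 = T * γ * X + δ) :
    (D * ((-l * Y * e - y * v) * (-l * X * d - x * u) + b * (e + l * y * Y * v) * (-a * (x * X * d + l * u))) =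
      (-l * Y * d1 * d - n1 * u) * (-l * n2 * e - x * d2 * v) + a * (d1 * d + l * n1 * Y * u) * (-b * (x * n2 * e + l * d2 * v))) ∧
    (D * ((-l * Y * e - y * v) * (a * (d + l * x * X * u)) + b * (e + l * y * Y * v) * (l * x * d + X * u)) =
      (-l * Y * d1 * d - n1 * u) * (b * (d2 * e + l * x * n2 * v)) + a * (d1 * d + l * n1 * Y * u) * (l * x * d2 * e + n2 * v)) ∧
    (D * (-b * (y * Y * e + l * v) * (-l * X * d - x * u) + (l * y * e + Y * v) * (-a * (x * X * d + l * u))) =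
      -a * (n1 * Y * d + l * d1 * u) * (-l * n2 * e - x * d2 * v) + (l * n1 * d + Y * d1 * u) * (-b * (x * n2 * e + l * d2 * v))) ∧
    (D * (-b * (y * Y * e + l * v) * (a * (d + l * x * X * u)) + (l * y * e + Y * v) * (l * x * d + X * u)) =
      -a * (n1 * Y * d + l * d1 * u) * (b * (d2 * e + l * x * n2 * v)) + (l * n1 * d + Y * d1 * u) * (l * x * d2 * e + n2 * v)) := by
  have huv : u * v =
      a * b * l^4 + a * b * l^2 * k + a * b - a * B * l * L - A * b * l * L + A * B * l^2 := by
    rw [hu, hv]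
    linear_combination (a * b) * hl
  have hTv : T * v =
      -a * b^4 * l - a * b^2 * l * k + a * b * B * L - a * l - A * b^2 * L + A * b * B * l := by
    rw [hT, hv]
    linear_combination (-a * l) * hb
  have hTu : T * u =
      a^4 * b * l + a^2 * b * l * k + a^2 * B * L - a * A * b * L - a * A * B * l + b * l := by
    rw [hT, hu]
    linear_combination (b * l) * ha
  have hTT : T^2 =
      a^4 * b^2 + a^2 * b^4 + 2 * a^2 * b^2 * k + a^2 - 2 * a * A * b * B + b^2 := by
    rw [hT]
    linear_combination (b^2) * ha
      + (a^2) * hb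
  have hTuv : T * u * v =
      a^4 * b^2 * l * L - a^4 * b * B * l^2 - a^2 * b^4 * l * L + a^2 * b * B * l^4 + a^2 * b * B
      - a^2 * l * L + a * A * b^4 * l^2 - a * A * b^2 * l^4 - a * A * b^2 + a * A * l^2 +
      b^2 * l * L - b * B * l^2 := by
    rw [hT, hu, hv]
    linear_combination (b^2 * l * L - b * B * l^2) * ha
      + (-a^2 * l * L + a * A * l^2) * hb
      + (a^2 * b * B - a * A * b^2) * hl
  have hTTv : T^2 * v =
      a^4 * b^3 * L - a^4 * b^2 * B * l + a^2 * b^5 * L - a^2 * b^4 * B * l + 2 * a^2 * b^3 * L *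
      k - 2 * a^2 * b^2 * B * l * k + a^2 * b * L - a^2 * B * l + 2 * a * A * b^5 * l + 2 *
      a * A * b^3 * l * k - 2 * a * A * b^2 * B * L + 2 * a * A * b * l + b^3 * L - b^2 * B
      * l := by
    rw [hT, hv]
    linear_combination (b^3 * L - b^2 * B * l) * ha
      + (a^2 * b * L - a^2 * B * l + 2 * a * A * b * l) * hb
  have hTTu : T^2 * u =
      a^5 * b^2 * L + 2 * a^5 * b * B * l - a^4 * A * b^2 * l + a^3 * b^4 * L + 2 * a^3 * b^2 * L
      * k + 2 * a^3 * b * B * l * k + a^3 * L - a^2 * A * b^4 * l - 2 * a^2 * A * b^2 * l *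
      k - 2 * a^2 * A * b * B * L - a^2 * A * l + a * b^2 * L + 2 * a * b * B * l - A * b^2
      * l := by
    rw [hT, hu]
    linear_combination (a * b^2 * L + 2 * a * b * B * l - A * b^2 * l) * ha
      + (a^3 * L - a^2 * A * l) * hb
  have hTTuv : T^2 * u * v =
      -2 * a^5 * b^5 * l^2 + a^5 * b^3 * l^4 - a^5 * b^3 * l^2 * k + a^5 * b^3 + a^5 * b^2 * B *
      l * L - 2 * a^5 * b * l^2 - a^4 * A * b^3 * l * L + a^4 * A * b^2 * B * l^2 + a^3 *
      b^5 * l^4 - a^3 * b^5 * l^2 * k + a^3 * b^5 - a^3 * b^4 * B * l * L + 2 * a^3 * b^3 *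
      l^4 * k + 2 * a^3 * b^3 * k + a^3 * b * l^4 - a^3 * b * l^2 * k + a^3 * b - a^3 * B *
      l * L + a^2 * A * b^5 * l * L + a^2 * A * b^4 * B * l^2 - 2 * a^2 * A * b^2 * B * l^4
      - 2 * a^2 * A * b^2 * B + a^2 * A * b * l * L + a^2 * A * B * l^2 - 2 * a * b^5 * l^2
      + a * b^3 * l^4 - a * b^3 * l^2 * k + a * b^3 + a * b^2 * B * l * L - 2 * a * b * l^2
      - A * b^3 * l * L + A * b^2 * B * l^2 := by
    rw [hT, hu, hv]
    linear_combination (a * b^3 * L^2 + a * b^2 * B * l * L - 2 * a * b * B^2 * l^2 - A * b^3 * l * L + A * b^2 * B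
      * l^2) * ha
      + (-2 * a^5 * b * l^2 - 2 * a^3 * b * l^2 * k + a^3 * b * L^2 - a^3 * B * l * L + a^2 * A * b
      * l * L + a^2 * A * B * l^2 - 2 * a * b * l^2) * hb
      + (a^5 * b^3 + a^3 * b^5 + 2 * a^3 * b^3 * k + a^3 * b - 2 * a^2 * A * b^2 * B + a * b^3) * hl
  rw [hD, hn1, hd1, hn2, hd2]
  refine ⟨?_, ?_, ?_, ?_⟩
  · linear_combination (norm := skip) (-α * δ * a * b * l * d * x * X * y * Y + α * δ * l * d * X * y + δ^2 * a * b * l * d - δ^2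
      * l * d * x * Y) * hv
    + (α^2 * a * b * l * e * x * X * y * Y - α^2 * l * e * X * y - α * δ * a * b * l * e + α * δ *
      l * e * x * Y) * hu
    + (α * γ * a * b * d * e * x * X * y - α * γ * l^2 * d * e * X * y * Y + β * δ * a * b * d * e
      * x - β * δ * l^2 * d * e * Y) * hT
    + (γ * δ * a * b * l * d * X + γ * δ * a * b * l * d * y - γ * δ * l * d * x * X * Y - γ * δ *
      l * d * x * y * Y) * hTv
    + (α * β * a * b * l * e * x * X * Y + α * β * a * b * l * e * x * y * Y - α * β * l * e * X -
      α * β * l * e * y) * hTu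
    + (α * γ * a * b * l^2 * X * y * Y - α * γ * x * X * y + β * δ * a * b * l^2 * Y - β * δ * x) * hTuv
    + (β * γ * a * b * d * e * x * X + β * γ * a * b * d * e * x * y - β * γ * l^2 * d * e * X * Y
      - β * γ * l^2 * d * e * y * Y) * hTT
    + (β * γ * a * b * l * d * x * X * y * Y - β * γ * l * d * X * y + γ^2 * a * b * l * d * X * y
      - γ^2 * l * d * x * X * y * Y) * hTTv
    + (β^2 * a * b * l * e * x * Y - β^2 * l * e + β * γ * a * b * l * e - β * γ * l * e * x * Y) * hTTu
    + (β * γ * a * b * l^2 * X * Y + β * γ * a * b * l^2 * y * Y - β * γ * x * X - β * γ * x * y) * hTTuv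
    simp only [hα, hβ, hγ, hδ, hd, he, hs]
    ring1
  · linear_combination (norm := skip) (-α * δ * a * d * X - α * δ * a * d * y + α * δ * b * l^2 * d * x * X * Y + α * δ * b * l^2
      * d * x * y * Y) * hv
    + (-α * δ * a * l^2 * e * x * X * Y - α * δ * a * l^2 * e * x * y * Y + α * δ * b * e * X + α
      * δ * b * e * y) * hu
    + (-α^2 * a * l * X * y * Y + α^2 * b * l * x * X * y - α * δ * a * l * x * X * y + α * δ * b
      * l * X * y * Y) * huv
    + (-γ * δ * a * l * d * e * x * X - γ * δ * a * l * d * e * x * y + γ * δ * b * l * d * e * X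
      * Y + γ * δ * b * l * d * e * y * Y) * hT
    + (-α * γ * a * d * X * y + α * γ * b * l^2 * d * x * X * y * Y - β * δ * a * d + β * δ * b *
      l^2 * d * x * Y) * hTv
    + (-α * γ * a * l^2 * e * x * X * y * Y + α * γ * b * e * X * y - β * δ * a * l^2 * e * x * Y
      + β * δ * b * e) * hTu
    + (-α * β * a * l * X * Y - α * β * a * l * y * Y + α * β * b * l * x * X + α * β * b * l * x
      * y) * hTuv
    + (β * γ * a * l * d * e * Y - β * γ * b * l * d * e * x - γ^2 * a * l * d * e * x * X * y +
      γ^2 * b * l * d * e * X * y * Y) * hTT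
    + (-β^2 * a * l * Y + β^2 * b * l * x + β * γ * a * l * x * X * y - β * γ * b * l * X * y * Y) * hTTuv
    simp only [hα, hβ, hγ, hδ, hd, he, hs]
    ring1
  · linear_combination (norm := skip) (-α * δ * a * d * x * X * Y - α * δ * a * d * x * y * Y + α * δ * b * l^2 * d * X + α * δ *
      b * l^2 * d * y) * hv
    + (-α * δ * a * l^2 * e * X - α * δ * a * l^2 * e * y + α * δ * b * e * x * X * Y + α * δ * b
      * e * x * y * Y) * hu
    + (-α * δ * a * l * Y + α * δ * b * l * x - δ^2 * a * l * x + δ^2 * b * l * Y) * huv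
    + (-α * β * a * l * d * e * X * Y - α * β * a * l * d * e * y * Y + α * β * b * l * d * e * x
      * X + α * β * b * l * d * e * x * y) * hT
    + (-α * γ * a * d * x * X * y * Y + α * γ * b * l^2 * d * X * y - β * δ * a * d * x * Y + β *
      δ * b * l^2 * d) * hTv
    + (-α * γ * a * l^2 * e * X * y + α * γ * b * e * x * X * y * Y - β * δ * a * l^2 * e + β * δ
      * b * e * x * Y) * hTu
    + (-γ * δ * a * l * x * X - γ * δ * a * l * x * y + γ * δ * b * l * X * Y + γ * δ * b * l * y
      * Y) * hTuv
    + (-β^2 * a * l * d * e * Y + β^2 * b * l * d * e * x + β * γ * a * l * d * e * x * X * y - β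
      * γ * b * l * d * e * X * y * Y) * hTT
    + (β * γ * a * l * Y - β * γ * b * l * x - γ^2 * a * l * x * X * y + γ^2 * b * l * X * y * Y) * hTTuv
    simp only [hα, hβ, hγ, hδ, hd, he, hs]
    ring1
  · linear_combination (norm := skip) (α^2 * a * b * l * d * x * X * y * Y - α^2 * l * d * X * y - α * δ * a * b * l * d + α * δ *
      l * d * x * Y) * hv
    + (-α * δ * a * b * l * e * x * X * y * Y + α * δ * l * e * X * y + δ^2 * a * b * l * e - δ^2
      * l * e * x * Y) * hu
    + (α * γ * a * b * d * e * X * y * Y - α * γ * l^2 * d * e * x * X * y + β * δ * a * b * d * e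
      * Y - β * δ * l^2 * d * e * x) * hT
    + (α * β * a * b * l * d * x * X * Y + α * β * a * b * l * d * x * y * Y - α * β * l * d * X -
      α * β * l * d * y) * hTv
    + (γ * δ * a * b * l * e * X + γ * δ * a * b * l * e * y - γ * δ * l * e * x * X * Y - γ * δ *
      l * e * x * y * Y) * hTu
    + (α * γ * a * b * l^2 * x * X * y - α * γ * X * y * Y + β * δ * a * b * l^2 * x - β * δ * Y) * hTuv
    + (β * γ * a * b * d * e * X * Y + β * γ * a * b * d * e * y * Y - β * γ * l^2 * d * e * x * X
      - β * γ * l^2 * d * e * x * y) * hTT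
    + (β^2 * a * b * l * d * x * Y - β^2 * l * d + β * γ * a * b * l * d - β * γ * l * d * x * Y) * hTTv
    + (β * γ * a * b * l * e * x * X * y * Y - β * γ * l * e * X * y + γ^2 * a * b * l * e * X * y
      - γ^2 * l * e * x * X * y * Y) * hTTu
    + (β * γ * a * b * l^2 * x * X + β * γ * a * b * l^2 * x * y - β * γ * X * Y - β * γ * y * Y) * hTTuv
    simp only [hα, hβ, hγ, hδ, hd, he, hs]
    ring1

/-- Lax factorization for the Krichever–Novikov Yang–Baxter map: there is a scalar `μ`
with `μ²·ρ(p;𝐚)·ρ(q;𝐛) = ρ(x;𝐚)·ρ(y;𝐛)` such that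
`W(y;𝐛,𝛌) W(x;𝐚,𝛌) = μ · W(p;𝐚,𝛌) W(q;𝐛,𝛌)` for all `𝛌 ∈ E_k` with nonzero
denominators. -/
theorem Wkn_factorization (k : ℂ) (a b : ℂ × ℂ)
    (ha : onJacobi k a) (hb : onJacobi k b)
    (x X y Y p P q Q : ℂ)
    (h1 : denKN y x Y a b ≠ 0) (h2 : denKN X x Y a b ≠ 0)
    (hp : p = Fkn y x Y a b) (hP : P = Y) (hq : q = x) (hQ : Q = Fkn X x Y a b)
    (hrx : rhoKN (x, X) a ≠ 0) (hry : rhoKN (y, Y) b ≠ 0)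
    (hrp : rhoKN (p, P) a ≠ 0) (hrq : rhoKN (q, Q) b ≠ 0) :
    ∃ μ : ℂ,
      μ ^ 2 * rhoKN (p, P) a * rhoKN (q, Q) b = rhoKN (x, X) a * rhoKN (y, Y) b ∧
      ∀ lam : ℂ × ℂ, onJacobi k lam →
        1 - a.1 ^ 2 * lam.1 ^ 2 ≠ 0 → 1 - b.1 ^ 2 * lam.1 ^ 2 ≠ 0 →
        Wkn (y, Y) b lam * Wkn (x, X) a lam =
          μ • (Wkn (p, P) a lam * Wkn (q, Q) b lam) := by
  obtain ⟨a, A⟩ := a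
  obtain ⟨b, B⟩ := b
  subst hP hq
  simp only [onJacobi] at ha hb
  obtain ⟨d1, hd1⟩ : ∃ d1, d1 = denKN y q P (a, A) (b, B) := ⟨_, rfl⟩
  obtain ⟨d2, hd2⟩ : ∃ d2, d2 = denKN X q P (a, A) (b, B) := ⟨_, rfl⟩
  simp only [Fkn] at hp hQ
  rw [← hd1] at h1 hp
  rw [← hd2] at h2 hQ
  simp only [denKN] at hd1 hd2
  obtain ⟨n1, hn1⟩ : ∃ n1, n1 = (1 - a ^ 2 * b ^ 2) * (b * P - a * q) * y +
      (a * B - b * A) * (q * P - a * b) := ⟨_, rfl⟩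
  obtain ⟨n2, hn2⟩ : ∃ n2, n2 = (1 - a ^ 2 * b ^ 2) * (b * P - a * q) * X +
      (a * B - b * A) * (q * P - a * b) := ⟨_, rfl⟩
  rw [← hn1] at hp
  rw [← hn2] at hQ
  have hpe : n1 = p * d1 := by rw [hp]; field_simp
  have hQe : n2 = Q * d2 := by rw [hQ]; field_simp
  have r1 := KN_rho1 k a A b B q y P ha hb _ _ n1 d1 rfl rfl hn1 hd1
  have r2 := KN_rho2 k a A b B q X P ha hb _ _ n2 d2 rfl rfl hn2 hd2
  have hDD := KN_D k a A b B q P ha hb _ _ rfl rfl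
  obtain ⟨H, hH⟩ : ∃ H, H = HKN k a A b B q P := ⟨_, rfl⟩
  rw [← hH] at r1 r2 hDD
  have e1 : d1 ^ 2 * rhoKN (p, P) (a, A) = a ^ 2 * H * rhoKN (y, P) (b, B) := by
    simp only [rhoKN]; rw [← r1, hpe]; ring
  have e2 : d2 ^ 2 * rhoKN (q, Q) (b, B) = b ^ 2 * H * rhoKN (q, X) (a, A) := by
    simp only [rhoKN]; rw [← r2, hQe]; ring
  have hne1 : a ^ 2 * H * rhoKN (y, P) (b, B) ≠ 0 := by
    rw [← e1]; exact mul_ne_zero (pow_ne_zero _ h1) hrp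
  have hne2 : b ^ 2 * H * rhoKN (q, X) (a, A) ≠ 0 := by
    rw [← e2]; exact mul_ne_zero (pow_ne_zero _ h2) hrq
  have ha0 : a ≠ 0 := by rintro rfl; simp at hne1
  have hb0 : b ≠ 0 := by rintro rfl; simp at hne2
  have hH0 : H ≠ 0 := by intro h; simp [h] at hne1
  have hD0 : a * b * H ≠ 0 := mul_ne_zero (mul_ne_zero ha0 hb0) hH0
  refine ⟨d1 * d2 / (a * b * H), ?_, ?_⟩
  · rw [div_pow, div_mul_eq_mul_div, div_mul_eq_mul_div, div_eq_iff (pow_ne_zero _ hD0)]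
    linear_combination d2 ^ 2 * rhoKN (q, Q) (b, B) * e1
      + a ^ 2 * H * rhoKN (y, P) (b, B) * e2
  · rintro ⟨l, L⟩ hl hda hdb
    simp only [onJacobi] at hl
    simp only at hda hdb
    obtain ⟨E00, E01, E10, E11⟩ := KN_entries k a A b B l L q X y P ha hb hl _ _ _ _ _ _ _ _ _ _
      (a * b * H) n1 d1 n2 d2 rfl rfl rfl rfl rfl rfl rfl rfl rfl rfl
      (by rw [← hDD]; ring) hn1 (by rw [hd1]) hn2 (by rw [hd2])
    rw [hpe, hQe] at E00 E01 E10 E11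
    obtain ⟨D, hD⟩ : ∃ D, D = a * b * H := ⟨_, rfl⟩
    obtain ⟨d, hd⟩ : ∃ d, d = 1 - a ^ 2 * l ^ 2 := ⟨_, rfl⟩
    obtain ⟨e, he⟩ : ∃ e, e = 1 - b ^ 2 * l ^ 2 := ⟨_, rfl⟩
    obtain ⟨u, hu⟩ : ∃ u, u = (a * L - A * l) / d := ⟨_, rfl⟩
    obtain ⟨v, hv⟩ : ∃ v, v = (b * L - B * l) / e := ⟨_, rfl⟩
    rw [← hd] at hda E00 E01 E10 E11
    rw [← he] at hdb E00 E01 E10 E11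
    rw [← hD] at hD0 E00 E01 E10 E11
    have hu' : a * L - A * l = u * d := by rw [hu]; field_simp
    have hv' : b * L - B * l = v * e := by rw [hv]; field_simp
    rw [hu', hv'] at E00 E01 E10 E11
    have hde : d * e ≠ 0 := mul_ne_zero hda hdb
    simp only [Wkn]
    rw [← hd, ← he, ← hu, ← hv, ← hD]
    ext i j
    fin_cases i <;> fin_cases j <;>
      simp only [Matrix.mul_apply, Fin.sum_univ_two, Matrix.smul_apply, smul_eq_mul,
        Matrix.of_apply, Matrix.cons_val', Matrix.cons_val_zero, Matrix.cons_val_one,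
        Matrix.cons_val_fin_one, Fin.zero_eta, Fin.mk_one, Fin.isValue] <;>
      rw [div_mul_eq_mul_div, eq_div_iff hD0] <;>
      apply mul_left_cancel₀ hde
    · linear_combination E00
    · linear_combination E01
    · linear_combination E10
    · linear_combination E11
end
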